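/- Lemma (one-step inequality for SEG-CC). Let F be L-Lipschitz and consider one SEG-CC step: x̃^k = x^k − γ₁ ĝ_{ξ^k}(x^k) and x^{k+1} = x^k − γ₂ ĝ_{η^k}(x̃^k), with γ₁ ≤ 1/(2L) and γ₂/γ₁ ≤ 1/2. Then for every u ∈ ℝ^d: 2γ₂⟨ḡ_{η^k}(x̃^k), x̃^k − u⟩ ≤ ‖x^k − u‖² − ‖x^{k+1} − u‖² − 2γ₂⟨ĝ_{η^k}(x̃^k) − ḡ_{η^k}(x̃^k), x^k − u⟩ + 2γ₂²‖ĝ_{η^k}(x̃^k) − ḡ_{η^k}(x̃^k)‖² + 4γ₁γ₂‖ḡ_{η^k}(x̃^k) − F(x̃^k)‖² + 4γ₁γ₂‖F(x^k) − ḡ_{ξ^k}(x^k)‖² + 4γ₁γ₂‖ḡ_{ξ^k}(x^k) − ĝ_{ξ^k}(x^k)‖². -/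

import Mathlib

open scoped RealInnerProductSpace

/-- The square of the norm of a sum of two vectors is at most twice the sum of the squares. -/
lemma norm_add_sq_le_two_mul {E : Type*} [SeminormedAddCommGroup E] (x y : E) :
    ‖x + y‖ ^ 2 ≤ 2 * (‖x‖ ^ 2 + ‖y‖ ^ 2) :=
  (pow_le_pow_left₀ (norm_nonneg _) (norm_add_le x y) 2).trans add_sq_le

/-- The square of the norm of a sum of four vectors is at most four times the sum of the
squares. -/
lemma norm_add_four_sq_le {E : Type*} [SeminormedAddCommGroup E] (x y z w : E) :
    ‖(x + y) + (z + w)‖ ^ 2 ≤ 4 * (‖x‖ ^ 2 + ‖y‖ ^ 2 + ‖z‖ ^ 2 + ‖w‖ ^ 2) := by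
  linarith [norm_add_sq_le_two_mul (x + y) (z + w), norm_add_sq_le_two_mul x y,
    norm_add_sq_le_two_mul z w]

/-- Bound on the error of an extrapolation direction `a` against a direction `p` at the
extrapolated point `x - γ • a`, for a map that is `L`-Lipschitz with `2 * γ * L ≤ 1`. -/
lemma norm_sq_sub_two_mul_inner_le {E : Type*} [NormedAddCommGroup E] [InnerProductSpace ℝ E]
    {L γ : ℝ} (hγ : 0 ≤ γ) (hγL : 2 * (L * γ) ≤ 1) {F : E → E}
    (hLip : ∀ y z, ‖F y - F z‖ ≤ L * ‖y - z‖) (x a g p : E) :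
    ‖p‖ ^ 2 - 2 * ⟪p, a⟫ ≤
      4 * (‖p - F (x - γ • a)‖ ^ 2 + ‖F x - g‖ ^ 2 + ‖g - a‖ ^ 2) := by
  have hF : ‖F (x - γ • a) - F x‖ ≤ L * γ * ‖a‖ := by
    simpa [norm_smul, abs_of_nonneg hγ, mul_assoc] using hLip (x - γ • a) x
  have hF2 : 4 * ‖F (x - γ • a) - F x‖ ^ 2 ≤ ‖a‖ ^ 2 := by
    have h : 2 * ‖F (x - γ • a) - F x‖ ≤ ‖a‖ := by
      nlinarith [mul_le_mul_of_nonneg_right hγL (norm_nonneg a)]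
    nlinarith [pow_le_pow_left₀ (by positivity) h 2]
  have hsum := norm_add_four_sq_le (p - F (x - γ • a)) (F (x - γ • a) - F x) (F x - g) (g - a)
  rw [sub_add_sub_cancel, sub_add_sub_cancel, sub_add_sub_cancel, norm_sub_sq_real] at hsum
  linarith

/-- **Lemma (one-step inequality for SEG-CC).**
Let `F` be `L`-Lipschitz and consider one SEG-CC step
`x̃^k = x^k − γ₁ ĝ_{ξ^k}(x^k)` and `x^{k+1} = x^k − γ₂ ĝ_{η^k}(x̃^k)`, with `γ₁ ≤ 1/(2L)`
and `γ₂/γ₁ ≤ 1/2`.  Then for every `u ∈ ℝ^d` the stated deterministic inequality holds. -/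
theorem seg_cc_one_step_inequality
    {d : ℕ} (L γ₁ γ₂ : ℝ) (hL : 0 < L)
    (hγ₁ : 0 < γ₁) (hγ₂ : 0 ≤ γ₂)
    (hγ₁L : γ₁ ≤ 1 / (2 * L)) (hβ : γ₂ / γ₁ ≤ 1 / 2)
    (F : EuclideanSpace ℝ (Fin d) → EuclideanSpace ℝ (Fin d))
    -- Assumption 3 (L-Lipschitzness)
    (hLip : ∀ y z, ‖F y - F z‖ ≤ L * ‖y - z‖)
    (xk xt xnext ghatxi ghateta gbarxi gbareta : EuclideanSpace ℝ (Fin d))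
    (hxt : xt = xk - γ₁ • ghatxi)
    (hxnext : xnext = xk - γ₂ • ghateta) :
    ∀ u : EuclideanSpace ℝ (Fin d),
      2 * γ₂ * ⟪gbareta, xt - u⟫
        ≤ ‖xk - u‖ ^ 2 - ‖xnext - u‖ ^ 2
          - 2 * γ₂ * ⟪ghateta - gbareta, xk - u⟫
          + 2 * γ₂ ^ 2 * ‖ghateta - gbareta‖ ^ 2
          + 4 * γ₁ * γ₂ * ‖gbareta - F xt‖ ^ 2
          + 4 * γ₁ * γ₂ * ‖F xk - gbarxi‖ ^ 2
          + 4 * γ₁ * γ₂ * ‖gbarxi - ghatxi‖ ^ 2 := by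
  intro u
  have hγL : 2 * (L * γ₁) ≤ 1 := by
    rw [le_div_iff₀ (by positivity)] at hγ₁L
    linarith
  have hγ : γ₂ ≤ γ₁ / 2 := by
    rw [div_le_iff₀ hγ₁] at hβ
    linarith
  have hextra := norm_sq_sub_two_mul_inner_le hγ₁.le hγL hLip xk ghatxi gbarxi gbareta
  rw [← hxt] at hextra
  have hsplit := norm_add_sq_le_two_mul (ghateta - gbareta) gbareta
  rw [sub_add_cancel] at hsplit
  have hleft : ⟪gbareta, xt - u⟫ = ⟪gbareta, xk - u⟫ - γ₁ * ⟪gbareta, ghatxi⟫ := by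
    rw [hxt, sub_right_comm, inner_sub_right, real_inner_smul_right]
  have hnext : ‖xnext - u‖ ^ 2 =
      ‖xk - u‖ ^ 2 - 2 * γ₂ * ⟪ghateta, xk - u⟫ + γ₂ ^ 2 * ‖ghateta‖ ^ 2 := by
    rw [hxnext, sub_right_comm, norm_sub_sq_real, real_inner_smul_right, norm_smul, mul_pow,
      Real.norm_eq_abs, sq_abs, real_inner_comm]
    ring
  rw [hleft, hnext, inner_sub_left]
  have h₁ := mul_le_mul_of_nonneg_left hextra (mul_nonneg hγ₁.le hγ₂)
  have h₂ := mul_le_mul_of_nonneg_left hsplit (sq_nonneg γ₂)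
  have h₃ := mul_le_mul_of_nonneg_right (mul_le_mul_of_nonneg_left hγ hγ₂)
    (sq_nonneg ‖gbareta‖)
  linarith
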